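/- Let G be a simple graph on {1,…,n} such that E_G is finite-dimensional, and let d₀ be the largest d with E_G^{d₀} ≠ 0. Then dim_ℚ E_G^{d₀} = 1, and E_G^{d₀} is spanned by a single product of generators x_{i_1 j_1}⋯x_{i_{d₀} j_{d₀}} with each {i_k, j_k} an edge of G. -/

import Mathlib

open scoped TensorProduct

namespace FK

/-- Defining relations of the Fomin–Kirillov algebra `E n`, with generators indexed by
ordered pairs `(i, j)`; we also impose `x_{ii} = 0` and the antisymmetry `x_{ji} = -x_{ij}`,
so that the generators of the algebra are the `x_{ij}` for `i < j`. -/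
inductive Rel (n : ℕ) : FreeAlgebra ℚ (Fin n × Fin n) → FreeAlgebra ℚ (Fin n × Fin n) → Prop
  | diag (i : Fin n) : Rel n (FreeAlgebra.ι ℚ (i, i)) 0
  | antisymm (i j : Fin n) (hij : i ≠ j) :
      Rel n (FreeAlgebra.ι ℚ (j, i)) (-FreeAlgebra.ι ℚ (i, j))
  | square (i j : Fin n) (hij : i ≠ j) :
      Rel n (FreeAlgebra.ι ℚ (i, j) * FreeAlgebra.ι ℚ (i, j)) 0
  | comm (i j k l : Fin n) (h : List.Nodup [i, j, k, l]) :
      Rel n (FreeAlgebra.ι ℚ (i, j) * FreeAlgebra.ι ℚ (k, l))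
        (FreeAlgebra.ι ℚ (k, l) * FreeAlgebra.ι ℚ (i, j))
  | cyclic (i j k : Fin n) (h : List.Nodup [i, j, k]) :
      Rel n (FreeAlgebra.ι ℚ (i, j) * FreeAlgebra.ι ℚ (j, k)
        + FreeAlgebra.ι ℚ (j, k) * FreeAlgebra.ι ℚ (k, i)
        + FreeAlgebra.ι ℚ (k, i) * FreeAlgebra.ι ℚ (i, j)) 0

/-- The Fomin–Kirillov algebra `E n`. -/
abbrev E (n : ℕ) : Type := RingQuot (Rel n)

/-- The generator `x_{ij}` of `E n`. -/
noncomputable def x (n : ℕ) (i j : Fin n) : E n :=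
  RingQuot.mkAlgHom ℚ (Rel n) (FreeAlgebra.ι ℚ (i, j))

/-- The product of generators `x_{i₁j₁} ⋯ x_{i_d j_d}` given by a list of pairs. -/
noncomputable def word (n : ℕ) (l : List (Fin n × Fin n)) : E n :=
  (l.map fun p => x n p.1 p.2).prod

/-- The degree-`d` component of `E n`: the span of products of `d` generators. -/
def degSpan (n : ℕ) (d : ℕ) : Submodule ℚ (E n) :=
  Submodule.span ℚ {y | ∃ l : List (Fin n × Fin n),
    (∀ p ∈ l, p.1 ≠ p.2) ∧ l.length = d ∧ y = word n l}

/-- The Fomin–Kirillov algebra of a graph `G`: the subalgebra of `E n` generated by the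
`x_{ij}` with `{i,j}` an edge of `G`. -/
def EG (n : ℕ) (G : SimpleGraph (Fin n)) : Subalgebra ℚ (E n) :=
  Algebra.adjoin ℚ {y | ∃ i j : Fin n, G.Adj i j ∧ y = x n i j}

/-- The degree-`d` component `E_G^d = E_G ∩ E_n^d`. -/
def EGdeg (n : ℕ) (G : SimpleGraph (Fin n)) (d : ℕ) : Submodule ℚ (E n) :=
  (EG n G).toSubmodule ⊓ degSpan n d

/-- The positive-degree part `E_G⁺` of `E_G`. -/
def EGplus (n : ℕ) (G : SimpleGraph (Fin n)) : Submodule ℚ (E n) :=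
  ⨆ d : ℕ, ⨆ _ : 1 ≤ d, EGdeg n G d


lemma x_diag (n : ℕ) (i : Fin n) : x n i i = 0 := by
  have := RingQuot.mkAlgHom_rel ℚ (Rel.diag (n := n) i)
  simpa [x] using this

lemma x_antisymm (n : ℕ) (i j : Fin n) : x n j i = - x n i j := by
  by_cases hij : i = j
  · subst hij; simp [x_diag]
  · have := RingQuot.mkAlgHom_rel ℚ (Rel.antisymm (n := n) i j hij)
    rw [map_neg] at this
    exact this

lemma x_square (n : ℕ) (i j : Fin n) : x n i j * x n i j = 0 := by
  by_cases hij : i = j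
  · subst hij; simp [x_diag]
  · have := RingQuot.mkAlgHom_rel ℚ (Rel.square (n := n) i j hij)
    rw [map_mul, map_zero] at this
    exact this

lemma x_comm (n : ℕ) (i j k l : Fin n) (h : List.Nodup [i, j, k, l]) :
    x n i j * x n k l = x n k l * x n i j := by
  have := RingQuot.mkAlgHom_rel ℚ (Rel.comm (n := n) i j k l h)
  rw [map_mul, map_mul] at this
  exact this

lemma x_cyclic (n : ℕ) (i j k : Fin n) (h : List.Nodup [i, j, k]) :
    x n i j * x n j k + x n j k * x n k i + x n k i * x n i j = 0 := by
  have := RingQuot.mkAlgHom_rel ℚ (Rel.cyclic (n := n) i j k h)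
  simp only [map_add, map_mul, map_zero] at this
  exact this

/-- Universal property of `E n`. -/
lemma exists_lift (n : ℕ) {A : Type} [Ring A] [Algebra ℚ A] (f : Fin n → Fin n → A)
    (h1 : ∀ i, f i i = 0) (h2 : ∀ i j, i ≠ j → f j i = - f i j)
    (h3 : ∀ i j, i ≠ j → f i j * f i j = 0)
    (h4 : ∀ i j k l, List.Nodup [i, j, k, l] → f i j * f k l = f k l * f i j)
    (h5 : ∀ i j k, List.Nodup [i, j, k] →
      f i j * f j k + f j k * f k i + f k i * f i j = 0) :
    ∃ F : E n →ₐ[ℚ] A, ∀ i j, F (x n i j) = f i j := by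
  refine ⟨RingQuot.liftAlgHom ℚ ⟨FreeAlgebra.lift ℚ fun p => f p.1 p.2, ?_⟩, ?_⟩
  · intro a b hab
    induction hab with
    | diag i => simpa using h1 i
    | antisymm i j hij => simpa using h2 i j hij
    | square i j hij => simpa using h3 i j hij
    | comm i j k l h => simpa using h4 i j k l h
    | cyclic i j k h => simpa using h5 i j k h
  · intro i j
    simp [x]

lemma algHom_ext' (n : ℕ) {A : Type} [Ring A] [Algebra ℚ A] (F F' : E n →ₐ[ℚ] A)
    (h : ∀ i j, F (x n i j) = F' (x n i j)) : F = F' := by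
  apply RingQuot.ringQuot_ext'
  apply FreeAlgebra.hom_ext
  funext p
  exact h p.1 p.2

lemma exists_act (n : ℕ) (w : Equiv.Perm (Fin n)) :
    ∃ F : E n →ₐ[ℚ] E n, ∀ i j, F (x n i j) = x n (w i) (w j) := by
  apply exists_lift n (fun i j => x n (w i) (w j))
  · intro i; exact x_diag n _
  · intro i j _; exact x_antisymm n _ _
  · intro i j _; exact x_square n _ _
  · intro i j k l h
    exact x_comm n _ _ _ _ (by simpa using h.map w.injective)
  · intro i j k h
    exact x_cyclic n _ _ _ (by simpa using h.map w.injective)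

/-- The action of a permutation on `E n`. -/
noncomputable def act (n : ℕ) (w : Equiv.Perm (Fin n)) : E n →ₐ[ℚ] E n :=
  (exists_act n w).choose

lemma act_x (n : ℕ) (w : Equiv.Perm (Fin n)) (i j : Fin n) :
    act n w (x n i j) = x n (w i) (w j) := (exists_act n w).choose_spec i j

/-- The algebra of linear endomorphisms of `E n`. -/
def EndE (n : ℕ) : Type := Module.End ℚ (E n)

noncomputable instance (n : ℕ) : Ring (EndE n) := inferInstanceAs (Ring (Module.End ℚ (E n)))

noncomputable instance (n : ℕ) : Algebra ℚ (EndE n) :=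
  inferInstanceAs (Algebra ℚ (Module.End ℚ (E n)))

/-- Evaluation at `1`. -/
noncomputable def ev (n : ℕ) : EndE n →ₗ[ℚ] E n where
  toFun a := (show Module.End ℚ (E n) from a) 1
  map_add' _ _ := rfl
  map_smul' _ _ := rfl

/-- The action as an element of the endomorphism algebra. -/
noncomputable def actE (n : ℕ) (w : Equiv.Perm (Fin n)) : EndE n :=
  (act n w).toLinearMap

lemma actE_mul (n : ℕ) (w v : Equiv.Perm (Fin n)) : actE n w * actE n v = actE n (w * v) := by
  have : (act n w).comp (act n v) = act n (w * v) := by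
    apply algHom_ext'
    intro i j
    simp [act_x]
  apply LinearMap.ext
  intro y
  exact DFunLike.congr_fun this y

lemma actE_one (n : ℕ) : actE n 1 = 1 := by
  have : act n 1 = AlgHom.id ℚ (E n) := by
    apply algHom_ext'
    intro i j
    simp [act_x]
  apply LinearMap.ext
  intro y
  exact DFunLike.congr_fun this y

/-- Left multiplication, as an algebra map. -/
noncomputable def L (n : ℕ) : E n →ₐ[ℚ] EndE n where
  toFun := fun a => (Algebra.lmul ℚ (E n) a : Module.End ℚ (E n))
  map_one' := map_one (Algebra.lmul ℚ (E n))
  map_mul' := map_mul (Algebra.lmul ℚ (E n))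
  map_zero' := map_zero (Algebra.lmul ℚ (E n))
  map_add' := map_add (Algebra.lmul ℚ (E n))
  commutes' := (Algebra.lmul ℚ (E n)).commutes

lemma ev_L (n : ℕ) (y : E n) : ev n (L n y) = y := mul_one y

lemma actE_L (n : ℕ) (w : Equiv.Perm (Fin n)) (i j : Fin n) :
    actE n w * L n (x n i j) = L n (x n (w i) (w j)) * actE n w := by
  apply LinearMap.ext
  intro y
  change act n w (x n i j * y) = x n (w i) (w j) * act n w y
  rw [map_mul, act_x]

/-- The value of the coproduct on generators. -/
noncomputable def cop0 (n : ℕ) (i j : Fin n) : EndE n ⊗[ℚ] E n :=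
  L n (x n i j) ⊗ₜ 1 + actE n (Equiv.swap i j) ⊗ₜ x n i j

lemma exists_cop (n : ℕ) : ∃ F : E n →ₐ[ℚ] EndE n ⊗[ℚ] E n,
    ∀ i j, F (x n i j) = cop0 n i j := by
  apply exists_lift n (cop0 n)
  · intro i
    simp only [cop0, x_diag, map_zero, TensorProduct.zero_tmul, TensorProduct.tmul_zero, add_zero]
  · intro i j _
    simp only [cop0, x_antisymm n i j, map_neg, TensorProduct.neg_tmul, TensorProduct.tmul_neg,
      Equiv.swap_comm j i]
    abel
  · intro i j _
    have h := actE_L n (Equiv.swap i j) i j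
    rw [Equiv.swap_apply_left, Equiv.swap_apply_right, x_antisymm n i j, map_neg, neg_mul] at h
    simp only [cop0, add_mul, mul_add, Algebra.TensorProduct.tmul_mul_tmul, ← map_mul, x_square,
      map_zero, mul_one, one_mul, h, TensorProduct.zero_tmul, TensorProduct.tmul_zero,
      TensorProduct.neg_tmul]
    abel
  · intro i j k l h
    have h' := h
    simp only [List.nodup_cons, List.mem_cons, List.not_mem_nil, not_or, or_false,
      not_false_eq_true, List.nodup_nil, and_true] at h'
    obtain ⟨⟨h12, h13, h14⟩, ⟨h23, h24⟩, h34⟩ := h'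
    have a1 := actE_L n (Equiv.swap i j) k l
    have a2 := actE_L n (Equiv.swap k l) i j
    rw [Equiv.swap_apply_of_ne_of_ne (Ne.symm h13) (Ne.symm h23),
      Equiv.swap_apply_of_ne_of_ne (Ne.symm h14) (Ne.symm h24)] at a1
    rw [Equiv.swap_apply_of_ne_of_ne h13 h14, Equiv.swap_apply_of_ne_of_ne h23 h24] at a2
    have a3 : Equiv.swap i j * Equiv.swap k l = Equiv.swap k l * Equiv.swap i j := by
      apply Equiv.Perm.Disjoint.commute
      intro y
      by_cases hy : y = i ∨ y = j
      · right
        rcases hy with rfl | rfl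
        · exact Equiv.swap_apply_of_ne_of_ne h13 h14
        · exact Equiv.swap_apply_of_ne_of_ne h23 h24
      · left
        push Not at hy
        exact Equiv.swap_apply_of_ne_of_ne hy.1 hy.2
    simp only [cop0, add_mul, mul_add, Algebra.TensorProduct.tmul_mul_tmul, ← map_mul,
      mul_one, one_mul, a1, a2, actE_mul, a3, x_comm n i j k l h]
    abel
  · intro i j k h
    have h' := h
    simp only [List.nodup_cons, List.mem_cons, List.not_mem_nil, not_or, or_false,
      not_false_eq_true, List.nodup_nil, and_true] at h'
    obtain ⟨⟨h12, h13⟩, h23⟩ := h'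
    have key : ∀ a b c : Fin n, a ≠ b → a ≠ c →
        actE n (Equiv.swap b c) * L n (x n c a) = - (L n (x n a b) * actE n (Equiv.swap b c)) := by
      intro a b c hab hac
      rw [actE_L, Equiv.swap_apply_right, Equiv.swap_apply_of_ne_of_ne hab hac,
        x_antisymm n a b, map_neg, neg_mul]
    have k1 := key i j k h12 h13
    have k2 := key j k i h23 (Ne.symm h12)
    have k3 := key k i j (Ne.symm h13) (Ne.symm h23)
    have s1 : Equiv.swap j k * Equiv.swap k i = Equiv.swap i j * Equiv.swap j k := by
      ext y
      simp only [Equiv.Perm.mul_apply, Equiv.swap_apply_def]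
      grind
    have s2 : Equiv.swap k i * Equiv.swap i j = Equiv.swap i j * Equiv.swap j k := by
      ext y
      simp only [Equiv.Perm.mul_apply, Equiv.swap_apply_def]
      grind
    have c := x_cyclic n i j k h
    have e1 := congrArg (fun y => L n y ⊗ₜ[ℚ] (1 : E n)) c
    have e2 := congrArg (fun y => actE n (Equiv.swap i j * Equiv.swap j k) ⊗ₜ[ℚ] y) c
    simp only [map_add, map_zero, TensorProduct.zero_tmul, TensorProduct.tmul_zero,
      TensorProduct.add_tmul, TensorProduct.tmul_add] at e1 e2
    simp only [cop0, add_mul, mul_add, Algebra.TensorProduct.tmul_mul_tmul, ← map_mul,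
      mul_one, one_mul, k1, k2, k3, actE_mul, s1, s2, TensorProduct.neg_tmul]
    rw [← add_zero (0 : EndE n ⊗[ℚ] E n)]
    nth_rewrite 1 [← e1]
    rw [← e2]
    abel

/-- The (braided) coproduct. -/
noncomputable def cop (n : ℕ) : E n →ₐ[ℚ] EndE n ⊗[ℚ] E n :=
  (exists_cop n).choose

lemma cop_x (n : ℕ) (i j : Fin n) :
    cop n (x n i j) = L n (x n i j) ⊗ₜ 1 + actE n (Equiv.swap i j) ⊗ₜ x n i j :=
  (exists_cop n).choose_spec i j

open Polynomial in
lemma exists_gr (n : ℕ) : ∃ F : E n →ₐ[ℚ] (E n)[X],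
    ∀ i j, F (x n i j) = Polynomial.monomial 1 (x n i j) := by
  apply exists_lift n (fun i j => Polynomial.monomial 1 (x n i j))
  · intro i; simp [x_diag]
  · intro i j _; rw [x_antisymm n i j, map_neg]
  · intro i j _; simp [Polynomial.monomial_mul_monomial, x_square]
  · intro i j k l h; simp [Polynomial.monomial_mul_monomial, x_comm n i j k l h]
  · intro i j k h
    simp only [Polynomial.monomial_mul_monomial, ← map_add, x_cyclic n i j k h, map_zero]

lemma word_nil (n : ℕ) : word n [] = 1 := by simp [word]

lemma word_cons (n : ℕ) (p : Fin n × Fin n) (l : List (Fin n × Fin n)) :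
    word n (p :: l) = x n p.1 p.2 * word n l := by simp [word]

lemma word_append (n : ℕ) (l l' : List (Fin n × Fin n)) :
    word n (l ++ l') = word n l * word n l' := by simp [word]

lemma exists_proj (n d : ℕ) : ∃ P : E n →ₗ[ℚ] E n,
    ∀ l, P (word n l) = if l.length = d then word n l else 0 := by
  obtain ⟨F, hF⟩ := exists_gr n
  have h : ∀ l, F (word n l) = Polynomial.monomial l.length (word n l) := by
    intro l
    induction l with
    | nil => simp [word_nil]
    | cons p l ih =>
      rw [word_cons, map_mul, ih, hF, Polynomial.monomial_mul_monomial, List.length_cons, add_comm]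
  refine ⟨((Polynomial.lcoeff (E n) d).restrictScalars ℚ).comp F.toLinearMap, ?_⟩
  intro l
  simp [h, Polynomial.coeff_monomial]

/-- Projection to degree `d`. -/
noncomputable def proj (n d : ℕ) : E n →ₗ[ℚ] E n := (exists_proj n d).choose

lemma proj_word (n d : ℕ) (l : List (Fin n × Fin n)) :
    proj n d (word n l) = if l.length = d then word n l else 0 :=
  (exists_proj n d).choose_spec l

lemma EGdeg_eq (n : ℕ) (G : SimpleGraph (Fin n)) (d : ℕ) :
    EGdeg n G d = Submodule.span ℚ {y | ∃ l : List (Fin n × Fin n),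
      (∀ p ∈ l, G.Adj p.1 p.2) ∧ l.length = d ∧ y = word n l} := by
  apply le_antisymm
  · rintro y ⟨hy1, hy2⟩
    have hp : proj n d y = y := by
      clear hy1
      unfold degSpan at hy2
      induction hy2 using Submodule.span_induction with
      | mem y h =>
        obtain ⟨l, -, hl, rfl⟩ := h
        simp [proj_word, hl]
      | zero => simp
      | add a b _ _ ha hb =>
        rw [map_add, ha, hb]
      | smul c a _ ha => rw [map_smul, ha]
    rw [← hp]
    have hy1' : y ∈ Subalgebra.toSubmodule (EG n G) := hy1
    rw [EG, Algebra.adjoin_eq_span] at hy1'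
    clear hp hy1 hy2
    induction hy1' using Submodule.span_induction with
    | mem y h =>
      have : ∃ l : List (Fin n × Fin n), (∀ p ∈ l, G.Adj p.1 p.2) ∧ y = word n l := by
        induction h using Submonoid.closure_induction with
        | mem y h =>
          obtain ⟨i, j, hij, rfl⟩ := h
          exact ⟨[(i, j)], by simpa using hij, by simp [word]⟩
        | one => exact ⟨[], by simp, by simp [word]⟩
        | mul a b _ _ ha hb =>
          obtain ⟨l, hl, rfl⟩ := ha
          obtain ⟨l', hl', rfl⟩ := hb
          refine ⟨l ++ l', ?_, (word_append n l l').symm⟩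
          intro p hp
          rcases List.mem_append.1 hp with hp | hp
          · exact hl p hp
          · exact hl' p hp
      obtain ⟨l, hl, rfl⟩ := this
      rw [proj_word]
      split_ifs with hd
      · exact Submodule.subset_span ⟨l, hl, hd, rfl⟩
      · exact Submodule.zero_mem _
    | zero => simp
    | add a b _ _ ha hb => rw [map_add]; exact Submodule.add_mem _ ha hb
    | smul c a _ ha => rw [map_smul]; exact Submodule.smul_mem _ _ ha
  · rw [Submodule.span_le]
    rintro y ⟨l, hl, hd, rfl⟩
    refine ⟨?_, Submodule.subset_span ⟨l, fun p hp => (hl p hp).ne, hd, rfl⟩⟩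
    clear hd
    change word n l ∈ EG n G
    induction l with
    | nil => rw [word_nil]; exact one_mem _
    | cons p l ih =>
      rw [word_cons]
      refine mul_mem (Algebra.subset_adjoin ⟨p.1, p.2, hl p (by simp), rfl⟩) ?_
      exact ih fun q hq => hl q (by simp [hq])

/-- Lower-degree part of the tensor product. -/
noncomputable def low (n d : ℕ) : Submodule ℚ (EndE n ⊗[ℚ] E n) :=
  Submodule.span ℚ {y | ∃ (a : EndE n) (l : List (Fin n × Fin n)),
    l.length < d ∧ y = a ⊗ₜ word n l}

lemma low_mul (n d d' : ℕ) (a : EndE n) (b : List (Fin n × Fin n))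
    (h : b.length + d ≤ d') (y : EndE n ⊗[ℚ] E n) (hy : y ∈ low n d) :
    (a ⊗ₜ word n b) * y ∈ low n d' := by
  unfold low at hy
  induction hy using Submodule.span_induction with
  | mem y hy =>
    obtain ⟨c, l, hl, rfl⟩ := hy
    rw [Algebra.TensorProduct.tmul_mul_tmul, ← word_append]
    exact Submodule.subset_span ⟨_, _, by rw [List.length_append]; omega, rfl⟩
  | zero => simp
  | add u v _ _ hu hv => rw [mul_add]; exact Submodule.add_mem _ hu hv
  | smul c u _ hu => rw [mul_smul_comm]; exact Submodule.smul_mem _ _ hu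

lemma cop_word (n : ℕ) (m : List (Fin n × Fin n)) :
    ∃ g : EndE n, ∃ r ∈ low n m.length, cop n (word n m) = g ⊗ₜ word n m + r := by
  induction m with
  | nil => exact ⟨1, 0, Submodule.zero_mem _, by simp [word_nil, Algebra.TensorProduct.one_def]⟩
  | cons p m ih =>
    obtain ⟨g, r, hr, h⟩ := ih
    refine ⟨actE n (Equiv.swap p.1 p.2) * g, (L n (x n p.1 p.2) * g) ⊗ₜ word n m
      + ((L n (x n p.1 p.2)) ⊗ₜ word n [] * r
      + actE n (Equiv.swap p.1 p.2) ⊗ₜ word n [p] * r), ?_, ?_⟩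
    · refine Submodule.add_mem _ (Submodule.subset_span ⟨_, m, by simp, rfl⟩)
        (Submodule.add_mem _ ?_ ?_)
      · exact low_mul n _ _ _ _ (by simp) _ hr
      · exact low_mul n _ _ _ _ (by simp [add_comm]) _ hr
    · rw [word_cons, map_mul, h, cop_x, word_cons, word_nil, mul_one]
      simp only [add_mul, mul_add, Algebra.TensorProduct.tmul_mul_tmul, one_mul]
      abel

lemma lTensor_low (n d : ℕ) (h : EndE n) (y : EndE n ⊗[ℚ] E n)
    (hy : y ∈ low n d) : (proj n d).lTensor _ ((h ⊗ₜ 1) * y) = 0 := by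
  unfold low at hy
  induction hy using Submodule.span_induction with
  | mem y hy =>
    obtain ⟨c, l, hl, rfl⟩ := hy
    rw [Algebra.TensorProduct.tmul_mul_tmul, one_mul, LinearMap.lTensor_tmul, proj_word,
      if_neg hl.ne, TensorProduct.tmul_zero]
  | zero => simp
  | add u v _ _ hu hv => rw [mul_add, map_add, hu, hv, add_zero]
  | smul c u _ hu => rw [mul_smul_comm, map_smul, hu, smul_zero]

lemma left_top (n : ℕ) (G : SimpleGraph (Fin n)) (t : E n)
    (ht : ∀ i j, G.Adj i j → t * x n i j = 0) (m : List (Fin n × Fin n))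
    (hm : ∀ p ∈ m, G.Adj p.1 p.2) :
    (1 ⊗ₜ t) * cop n (word n m) = L n (word n m) ⊗ₜ t := by
  induction m with
  | nil => simp [word_nil]
  | cons p m ih =>
    have ih := ih fun q hq => hm q (by simp [hq])
    have e : (1 ⊗ₜ t) * cop n (x n p.1 p.2) = (L n (x n p.1 p.2) ⊗ₜ 1) * (1 ⊗ₜ[ℚ] t) := by
      rw [cop_x, mul_add]
      simp [Algebra.TensorProduct.tmul_mul_tmul, ht p.1 p.2 (hm p (by simp))]
    rw [word_cons, map_mul, ← mul_assoc, e, mul_assoc, ih, Algebra.TensorProduct.tmul_mul_tmul,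
      one_mul, map_mul]

lemma right_top (n : ℕ) (G : SimpleGraph (Fin n)) (m : E n)
    (hm : ∀ i j, G.Adj i j → x n i j * m = 0) (t : List (Fin n × Fin n))
    (ht : ∀ p ∈ t, G.Adj p.1 p.2) :
    ∃ h : EndE n, (1 ⊗ₜ word n t) * cop n m = (h ⊗ₜ 1) * cop n m := by
  induction t with
  | nil => exact ⟨1, by simp [word_nil]⟩
  | cons p t ih =>
    obtain ⟨h, hh⟩ := ih fun q hq => ht q (by simp [hq])
    have z : cop n (x n p.1 p.2) * cop n m = 0 := by
      rw [← map_mul, hm _ _ (ht p (by simp)), map_zero]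
    have e : (1 : EndE n) ⊗ₜ[ℚ] x n p.1 p.2 =
        (actE n (Equiv.swap p.1 p.2) ⊗ₜ 1) * cop n (x n p.1 p.2)
        + (-(actE n (Equiv.swap p.1 p.2) * L n (x n p.1 p.2))) ⊗ₜ 1 := by
      rw [cop_x, mul_add]
      simp [Algebra.TensorProduct.tmul_mul_tmul, actE_mul, actE_one, TensorProduct.neg_tmul]
    refine ⟨h * -(actE n (Equiv.swap p.1 p.2) * L n (x n p.1 p.2)), ?_⟩
    have f : (1 : EndE n) ⊗ₜ[ℚ] word n (p :: t)
        = (1 ⊗ₜ x n p.1 p.2) * (1 ⊗ₜ word n t) := by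
      rw [word_cons, Algebra.TensorProduct.tmul_mul_tmul, one_mul]
    have g : ((1 : EndE n) ⊗ₜ[ℚ] x n p.1 p.2) * (h ⊗ₜ 1)
        = (h ⊗ₜ 1) * (1 ⊗ₜ x n p.1 p.2) := by
      simp [Algebra.TensorProduct.tmul_mul_tmul]
    rw [f, mul_assoc, hh, ← mul_assoc, g, mul_assoc, e, add_mul, mul_assoc, z, mul_zero, zero_add,
      ← mul_assoc, Algebra.TensorProduct.tmul_mul_tmul, one_mul]

lemma word_mem_span (n : ℕ) (G : SimpleGraph (Fin n)) (d : ℕ)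
    (hz : ∀ l : List (Fin n × Fin n), (∀ p ∈ l, G.Adj p.1 p.2) → d < l.length → word n l = 0)
    (m : List (Fin n × Fin n)) (hm : ∀ p ∈ m, G.Adj p.1 p.2) (hmd : m.length = d)
    (hm0 : word n m ≠ 0)
    (t : List (Fin n × Fin n)) (ht : ∀ p ∈ t, G.Adj p.1 p.2) (htd : t.length = d) :
    word n t ∈ Submodule.span ℚ {word n m} := by
  have h1 := left_top n G (word n t) (by
    intro i j hij
    have : x n i j = word n [(i, j)] := by simp [word]
    rw [this, ← word_append]
    apply hz
    · intro p hp
      rcases List.mem_append.1 hp with hp | hp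
      · exact ht p hp
      · rw [List.mem_singleton] at hp
        subst hp
        exact hij
    · simp [htd]) m hm
  obtain ⟨h, h2⟩ := right_top n G (word n m) (by
    intro i j hij
    rw [← word_cons n (i, j)]
    apply hz
    · intro p hp
      rcases List.mem_cons.1 hp with hp | hp
      · subst hp
        exact hij
      · exact hm p hp
    · simp [hmd]) t ht
  obtain ⟨g, r, hr, h3⟩ := cop_word n m
  rw [h1, h3, mul_add] at h2
  have h4 := congrArg ((proj n d).lTensor _) h2
  rw [hmd] at hr
  rw [map_add, lTensor_low n d h r hr, Algebra.TensorProduct.tmul_mul_tmul, one_mul,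
    LinearMap.lTensor_tmul, LinearMap.lTensor_tmul, proj_word, proj_word, if_pos hmd, if_pos htd,
    add_zero] at h4
  obtain ⟨φ, hφ⟩ : ∃ φ : Module.Dual ℚ (E n), φ (word n m) ≠ 0 := by
    by_contra hcon
    push Not at hcon
    exact hm0 ((Module.forall_dual_apply_eq_zero_iff ℚ _).1 hcon)
  have h5 := congrArg (fun y => TensorProduct.lid ℚ (E n)
    ((φ.comp (ev n)).rTensor (E n) y)) h4
  simp only [LinearMap.rTensor_tmul, TensorProduct.lid_tmul, LinearMap.comp_apply, ev_L] at h5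
  have h7 : word n t = (φ (word n m))⁻¹ • (φ (word n m) • word n t) := by
    rw [smul_smul, inv_mul_cancel₀ hφ, one_smul]
  rw [h7, h5]
  exact Submodule.smul_mem _ _ (Submodule.smul_mem _ _ (Submodule.mem_span_singleton_self _))

/-- if `E_G` is finite-dimensional and `d₀` is the largest `d` with
`E_G^{d₀} ≠ 0`, then `dim E_G^{d₀} = 1` and `E_G^{d₀}` is spanned by a single product of
generators `x_{i₁j₁}⋯x_{i_{d₀}j_{d₀}}` with each `{i_k, j_k}` an edge of `G`. -/
theorem stmt6 (n : ℕ) (hn : 1 ≤ n) (G : SimpleGraph (Fin n))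
    (hfd : FiniteDimensional ℚ ↥(EG n G)) (d₀ : ℕ)
    (h₀ : EGdeg n G d₀ ≠ ⊥) (hmax : ∀ d : ℕ, d₀ < d → EGdeg n G d = ⊥) :
    Module.finrank ℚ ↥(EGdeg n G d₀) = 1 ∧
    ∃ l : List (Fin n × Fin n), l.length = d₀ ∧ (∀ p ∈ l, G.Adj p.1 p.2) ∧
      EGdeg n G d₀ = Submodule.span ℚ {word n l} := by
  have hz : ∀ l : List (Fin n × Fin n), (∀ p ∈ l, G.Adj p.1 p.2) → d₀ < l.length →
      word n l = 0 := by
    intro l hl hd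
    have : word n l ∈ EGdeg n G l.length := by
      rw [EGdeg_eq]
      exact Submodule.subset_span ⟨l, hl, rfl, rfl⟩
    rw [hmax _ hd] at this
    simpa using this
  obtain ⟨m, hm, hmd, hm0⟩ : ∃ m : List (Fin n × Fin n), (∀ p ∈ m, G.Adj p.1 p.2) ∧
      m.length = d₀ ∧ word n m ≠ 0 := by
    by_contra hcon
    apply h₀
    rw [EGdeg_eq, Submodule.span_eq_bot]
    rintro y ⟨l, hl, hd, rfl⟩
    by_contra hne
    exact hcon ⟨l, hl, hd, hne⟩
  have key : EGdeg n G d₀ = Submodule.span ℚ {word n m} := by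
    rw [EGdeg_eq]
    apply le_antisymm
    · rw [Submodule.span_le]
      rintro y ⟨t, ht, htd, rfl⟩
      exact word_mem_span n G d₀ hz m hm hmd hm0 t ht htd
    · apply Submodule.span_mono
      rintro y rfl
      exact ⟨m, hm, hmd, rfl⟩
  refine ⟨?_, m, hmd, hm, key⟩
  rw [key]
  exact finrank_span_singleton hm0

end FK
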